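/- (Derivation on the number of blocks) Let t, m, s, v be positive integers with v ≥ 2, s ≤ t, and t ≤ ms. Then OCAN(t,m,s,v) ≤ ⌊OCAN(t+1,m+1,s,v)/v⌋. -/

import Mathlib

/-- An anti-ideal of the NRT poset `[m·s]`, whose elements are pairs
`(i, a) : Fin m × Fin s` (block `i`, position `a` within the block, positions
within a block forming a chain): an anti-ideal is an up-closed subset. -/
def IsAntiIdeal (m s : ℕ) (J : Finset (Fin m × Fin s)) : Prop :=
  ∀ i : Fin m, ∀ a b : Fin s, a ≤ b → (i, a) ∈ J → (i, b) ∈ J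

/-- Existence of an ordered covering array `OCA_λ(N; t, m, s, v)`:
an `N × ms` array over an alphabet of size `v`, columns indexed by the NRT poset
`[m·s]`, such that for every anti-ideal `J` of size `t`, every `t`-tuple appears
at least `lam` times as a row of the subarray given by the columns in `J`. -/
def IsOCA (lam N t m s v : ℕ) : Prop :=
  ∃ A : Fin N → Fin m × Fin s → Fin v,
    ∀ J : Finset (Fin m × Fin s), IsAntiIdeal m s J → J.card = t →
      ∀ f : Fin m × Fin s → Fin v,
        lam ≤ (Finset.univ.filter (fun r : Fin N => ∀ c ∈ J, A r c = f c)).card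

/-- The ordered covering array number `OCAN_λ(t, m, s, v)`. -/
noncomputable def OCAN (lam t m s v : ℕ) : ℕ := sInf {N | IsOCA lam N t m s v}

/-- The array whose rows are all words is an ordered covering array. -/
theorem exists_isOCA_one (t m s v : ℕ) : ∃ N, IsOCA 1 N t m s v := by
  let e := Fintype.equivFin (Fin m × Fin s → Fin v)
  refine ⟨_, fun r => e.symm r, fun J _ _ f => ?_⟩
  exact Finset.card_pos.2 ⟨e f, by simp⟩

/-- Adding the top element of a new last block to an anti-ideal gives an anti-ideal. -/
theorem IsAntiIdeal.insert_last {m s : ℕ} {J : Finset (Fin m × Fin (s + 1))}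
    (hJ : IsAntiIdeal m (s + 1) J) :
    IsAntiIdeal (m + 1) (s + 1) (insert (Fin.last m, Fin.last s)
      (J.image (Prod.map Fin.castSucc id))) := by
  intro i a b hab h
  induction i using Fin.lastCases with
  | last =>
    have ha : a = Fin.last s := by
      simpa [Prod.ext_iff, Fin.castSucc_ne_last] using h
    subst ha
    simp [Fin.last_le_iff.1 hab]
  | cast i =>
    have ha : (i, a) ∈ J := by
      simpa [Prod.ext_iff, Fin.castSucc_ne_last] using h
    simpa [Prod.ext_iff, Fin.castSucc_ne_last] using hJ i a b hab ha

theorem card_insert_last {m s : ℕ} (J : Finset (Fin m × Fin (s + 1))) :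
    (insert (Fin.last m, Fin.last s) (J.image (Prod.map Fin.castSucc id))).card
      = J.card + 1 := by
  rw [Finset.card_insert_of_notMem, Finset.card_image_of_injective]
  · exact (Fin.castSucc_injective m).prodMap Function.injective_id
  · simp [Prod.ext_iff, Fin.castSucc_ne_last]

/-- Keeping the rows with the rarest symbol in the top column of the last block, and deleting
that block, turns an ordered covering array into a smaller one. -/
theorem IsOCA.exists_derived {lam N t m s v : ℕ} (hv : 0 < v)
    (h : IsOCA lam N (t + 1) (m + 1) (s + 1) v) :
    ∃ K ≤ N / v, IsOCA lam K t m (s + 1) v := by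
  obtain ⟨A, hA⟩ := h
  obtain ⟨x, hx⟩ := Fintype.exists_card_fiber_lt_of_card_lt_mul
    (f := fun r => A r (Fin.last m, Fin.last s)) (n := N / v + 1)
    (by simpa using Nat.lt_mul_div_succ N hv)
  set S := Finset.univ.filter fun r => A r (Fin.last m, Fin.last s) = x with hS
  refine ⟨S.card, Nat.lt_succ_iff.1 hx,
    fun r c => A (S.equivFin.symm r) (c.1.castSucc, c.2), fun J hJ hJt f => ?_⟩
  refine (hA _ hJ.insert_last (by rw [card_insert_last, hJt])
    (fun p => Fin.lastCases (motive := fun _ => Fin v) x (fun i => f (i, p.2)) p.1)).trans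
    (Finset.card_le_card_of_surjOn (fun r => (S.equivFin.symm r : Fin N)) fun r hr => ?_)
  simp only [Finset.coe_filter, Finset.mem_univ, true_and, Set.mem_ofPred_eq,
    Finset.forall_mem_insert, Finset.forall_mem_image, Fin.lastCases_last, Prod.map_fst,
    Prod.map_snd, Fin.lastCases_castSucc, id_eq] at hr
  have hrS : r ∈ S := by simp [hS, hr.1]
  refine ⟨S.equivFin ⟨r, hrS⟩, ?_, by simp⟩
  refine Finset.mem_coe.2 (Finset.mem_filter.2 ⟨Finset.mem_univ _, fun c hc => ?_⟩)
  simpa [Prod.map] using hr.2 hc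

/-- Derivation on the number of blocks:
`OCAN(t,m,s,v) ≤ ⌊OCAN(t+1,m+1,s,v)/v⌋`. -/
theorem stmt_7 (t m s v : ℕ) (ht : 1 ≤ t) (hm : 1 ≤ m) (hs : 1 ≤ s)
    (hv : 2 ≤ v) (hst : s ≤ t) (htm : t ≤ m * s) :
    OCAN 1 t m s v ≤ OCAN 1 (t + 1) (m + 1) s v / v := by
  obtain ⟨s, rfl⟩ := Nat.exists_eq_add_of_le' hs
  have h : IsOCA 1 (OCAN 1 (t + 1) (m + 1) (s + 1) v) (t + 1) (m + 1) (s + 1) v :=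
    Nat.sInf_mem (exists_isOCA_one (t + 1) (m + 1) (s + 1) v)
  obtain ⟨K, hK, hKA⟩ := h.exists_derived (by omega)
  exact (Nat.sInf_le hKA).trans hK
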